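/- Let P be an (n+3)×(n+3) symmetric positive semidefinite real matrix whose 2×2 submatrix [[P_{1,1}, P_{1,n+3}],[P_{n+3,1}, P_{n+3,n+3}]] is invertible, y ∈ ℝ^{n+1}, and let Π be the (n+1)×(n+3) matrix with Π(x_1,...,x_{n+3})ᵀ = (x_2,...,x_{n+2})ᵀ. Then the minimization of ‖y − Π x‖² over {x ∈ ℝ^{n+3} : P x = 0} has a unique minimizer x^∞, and (λP + ΠᵀΠ)^{-1} Πᵀ y → x^∞ as λ → +∞. -/

import Mathlib

open Matrix Filter Topology

/-- The (n+1)×(n+3) matrix Π with Π(x₁,...,x_{n+3})ᵀ = (x₂,...,x_{n+2})ᵀ. -/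
def PiMat (n : ℕ) : Matrix (Fin (n + 1)) (Fin (n + 3)) ℝ :=
  Matrix.of fun i j => if (j : ℕ) = (i : ℕ) + 1 then 1 else 0

namespace PenalizedLeastSquares

variable {m k : Type*} [Fintype m] [Fintype k]

theorem dotProduct_gram_mulVec (B : Matrix k m ℝ) (x z : m → ℝ) :
    x ⬝ᵥ ((Bᵀ * B) *ᵥ z) = (B *ᵥ x) ⬝ᵥ (B *ᵥ z) := by
  rw [← mulVec_mulVec, dotProduct_mulVec, vecMul_transpose]

theorem dotProduct_mulVec_comm {P : Matrix m m ℝ} (hP : P.PosSemidef) (x z : m → ℝ) :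
    x ⬝ᵥ (P *ᵥ z) = z ⬝ᵥ (P *ᵥ x) := by
  have h : Pᵀ = P := by simpa using hP.1.eq
  rw [dotProduct_mulVec, ← mulVec_transpose, h, dotProduct_comm]

theorem dotProduct_mulVec_nonneg {P : Matrix m m ℝ} (hP : P.PosSemidef) (x : m → ℝ) :
    0 ≤ x ⬝ᵥ (P *ᵥ x) := by
  simpa using hP.dotProduct_mulVec_nonneg x

/-- The quadratic form of `P` along the line `u + t • x`. -/
theorem quadratic_nonneg {P : Matrix m m ℝ} (hP : P.PosSemidef) (x u : m → ℝ) (t : ℝ) :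
    0 ≤ (x ⬝ᵥ (P *ᵥ x)) * (t * t) + 2 * (u ⬝ᵥ (P *ᵥ x)) * t + u ⬝ᵥ (P *ᵥ u) := by
  have h := dotProduct_mulVec_nonneg hP (u + t • x)
  simp only [mulVec_add, mulVec_smul, dotProduct_add, add_dotProduct, dotProduct_smul,
    smul_dotProduct, smul_eq_mul] at h
  rw [dotProduct_mulVec_comm hP x u] at h
  linarith

/-- Cauchy–Schwarz for a positive semidefinite matrix. -/
theorem sq_dotProduct_mulVec_le {P : Matrix m m ℝ} (hP : P.PosSemidef) (x u : m → ℝ) :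
    (u ⬝ᵥ (P *ᵥ x)) ^ 2 ≤ (u ⬝ᵥ (P *ᵥ u)) * (x ⬝ᵥ (P *ᵥ x)) := by
  have h := discrim_le_zero (quadratic_nonneg hP x u)
  rw [discrim] at h
  linarith

theorem posDef_smul_add_gram {P : Matrix m m ℝ} (hP : P.PosSemidef) {B : Matrix k m ℝ}
    (hK : ∀ x, P *ᵥ x = 0 → B *ᵥ x = 0 → x = 0) {lam : ℝ} (hlam : 0 < lam) :
    (lam • P + Bᵀ * B).PosDef := by
  have hB : (Bᵀ * B).PosSemidef := by simpa using posSemidef_conjTranspose_mul_self B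
  refine PosDef.of_dotProduct_mulVec_pos ((hP.smul hlam.le).add hB).1 fun x hx => ?_
  simp only [star_trivial, add_mulVec, smul_mulVec, dotProduct_add, dotProduct_smul,
    smul_eq_mul]
  have h1 := dotProduct_mulVec_nonneg hP x
  have h2 := dotProduct_mulVec_nonneg hB x
  by_contra! hle
  have h3 : x ⬝ᵥ (P *ᵥ x) = 0 := by nlinarith
  have h4 : x ⬝ᵥ ((Bᵀ * B) *ᵥ x) = 0 := by nlinarith
  refine hx (hK x ?_ ?_)
  · exact (hP.dotProduct_mulVec_zero_iff x).1 (by simpa using h3)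
  · rw [dotProduct_gram_mulVec] at h4
    exact dotProduct_self_eq_zero.1 h4

/-- Every vector splits as the image under `BᵀB` of a vector of `ker P` plus a vector of the range
of `P`, provided that `ker P ∩ ker B` is trivial. -/
theorem exists_gram_mulVec_add {P : Matrix m m ℝ} (hP : P.PosSemidef) {B : Matrix k m ℝ}
    (hK : ∀ x, P *ᵥ x = 0 → B *ᵥ x = 0 → x = 0) (c : m → ℝ) :
    ∃ x w, P *ᵥ x = 0 ∧ (Bᵀ * B) *ᵥ x + P *ᵥ w = c := by
  let p := P.mulVecLin
  let T : (p.ker × p.range) →ₗ[ℝ] (m → ℝ) :=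
    ((Bᵀ * B).mulVecLin ∘ₗ p.ker.subtype).coprod p.range.subtype
  have hdim : Module.finrank ℝ (p.ker × p.range) = Module.finrank ℝ (m → ℝ) := by
    rw [Module.finrank_prod, add_comm, p.finrank_range_add_finrank_ker]
  have hinj : Function.Injective T := by
    rw [← LinearMap.ker_eq_bot, LinearMap.ker_eq_bot']
    rintro ⟨⟨x, hx⟩, ⟨_, w, rfl⟩⟩ h
    have hx' : P *ᵥ x = 0 := hx
    have h' : (Bᵀ * B) *ᵥ x + P *ᵥ w = 0 := h
    have hBx : B *ᵥ x = 0 := by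
      have h0 := congrArg (x ⬝ᵥ ·) h'
      simp only [dotProduct_add, dotProduct_zero, dotProduct_gram_mulVec,
        dotProduct_mulVec_comm hP x w, hx', add_zero] at h0
      exact dotProduct_self_eq_zero.1 h0
    obtain rfl := hK x hx' hBx
    have hw : P *ᵥ w = 0 := by simpa using h'
    ext1
    · rfl
    · exact Subtype.ext hw
  obtain ⟨⟨⟨x, hx⟩, ⟨_, w, rfl⟩⟩, h⟩ :=
    (LinearMap.injective_iff_surjective_of_finrank_eq_finrank hdim).1 hinj c
  exact ⟨x, w, hx, h⟩

theorem tendsto_inv_mulVec_range [DecidableEq m] {P : Matrix m m ℝ} (hP : P.PosSemidef) {B : Matrix k m ℝ}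
    (hK : ∀ x, P *ᵥ x = 0 → B *ᵥ x = 0 → x = 0) (w : m → ℝ) :
    Tendsto (fun lam : ℝ => (lam • P + Bᵀ * B)⁻¹ *ᵥ (P *ᵥ w)) atTop (𝓝 0) := by
  set N := (1 : ℝ) • P + Bᵀ * B with hN
  have hNpos : N.PosDef := posDef_smul_add_gram hP hK one_pos
  have hB : (Bᵀ * B).PosSemidef := by simpa using posSemidef_conjTranspose_mul_self B
  rw [tendsto_pi_nhds]
  intro i
  set u := N⁻¹ *ᵥ Pi.single i 1 with hu
  have hcoord (e : m → ℝ) : e i = u ⬝ᵥ (N *ᵥ e) := by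
    rw [dotProduct_mulVec_comm hNpos.posSemidef, hu, mulVec_mulVec,
      mul_nonsing_inv _ ((isUnit_iff_isUnit_det _).1 hNpos.isUnit), one_mulVec,
      dotProduct_single_one]
  set a := u ⬝ᵥ (N *ᵥ u)
  set b := w ⬝ᵥ (P *ᵥ w)
  have ha : 0 ≤ a := dotProduct_mulVec_nonneg hNpos.posSemidef u
  have hlim : Tendsto (fun lam : ℝ => √(a * (b / 2 * lam⁻¹))) atTop (𝓝 0) := by
    have := ((tendsto_inv_atTop_zero (𝕜 := ℝ)).const_mul (b / 2)).const_mul a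
    simpa using this.sqrt
  refine squeeze_zero_norm' ?_ hlim
  filter_upwards [eventually_ge_atTop 2] with lam hlam
  have hpos : 0 < lam := by linarith
  set e := (lam • P + Bᵀ * B)⁻¹ *ᵥ (P *ᵥ w) with he
  have heq : (lam • P + Bᵀ * B) *ᵥ e = P *ᵥ w := by
    rw [he, mulVec_mulVec, mul_nonsing_inv _
      ((isUnit_iff_isUnit_det _).1 (posDef_smul_add_gram hP hK hpos).isUnit), one_mulVec]
  have henergy : lam * (e ⬝ᵥ (P *ᵥ e)) + e ⬝ᵥ ((Bᵀ * B) *ᵥ e) = w ⬝ᵥ (P *ᵥ e) := by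
    rw [dotProduct_mulVec_comm hP w e, ← heq]
    simp [add_mulVec, smul_mulVec]
  have hyoung : 2 * (w ⬝ᵥ (P *ᵥ e)) ≤ lam * (e ⬝ᵥ (P *ᵥ e)) + b * lam⁻¹ := by
    have h := mul_nonneg (quadratic_nonneg hP e w (-lam)) (inv_nonneg.2 hpos.le)
    have h2 : (e ⬝ᵥ (P *ᵥ e) * (-lam * -lam) + 2 * (w ⬝ᵥ (P *ᵥ e)) * -lam + b) * lam⁻¹ =
        lam * (e ⬝ᵥ (P *ᵥ e)) - 2 * (w ⬝ᵥ (P *ᵥ e)) + b * lam⁻¹ := by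
      field_simp
      ring
    linarith
  have hNe : e ⬝ᵥ (N *ᵥ e) ≤ b / 2 * lam⁻¹ := by
    have h1 : e ⬝ᵥ (N *ᵥ e) = e ⬝ᵥ (P *ᵥ e) + e ⬝ᵥ ((Bᵀ * B) *ᵥ e) := by
      simp [hN, add_mulVec]
    have h2 := dotProduct_mulVec_nonneg hP e
    have h3 := dotProduct_mulVec_nonneg hB e
    nlinarith
  rw [Real.norm_eq_abs, hcoord e]
  exact Real.abs_le_sqrt ((sq_dotProduct_mulVec_le hNpos.posSemidef e u).trans
    (mul_le_mul_of_nonneg_left hNe ha))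

theorem tendsto_inv_mulVec [DecidableEq m] {P : Matrix m m ℝ} (hP : P.PosSemidef)
    {B : Matrix k m ℝ}
    (hK : ∀ x, P *ᵥ x = 0 → B *ᵥ x = 0 → x = 0) {x w c : m → ℝ} (hx : P *ᵥ x = 0)
    (hc : (Bᵀ * B) *ᵥ x + P *ᵥ w = c) :
    Tendsto (fun lam : ℝ => (lam • P + Bᵀ * B)⁻¹ *ᵥ c) atTop (𝓝 x) := by
  have h := (tendsto_inv_mulVec_range hP hK w).const_add x
  rw [add_zero] at h
  refine h.congr' ?_
  filter_upwards [eventually_gt_atTop 0] with lam hlam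
  have hx' : (lam • P + Bᵀ * B) *ᵥ x = (Bᵀ * B) *ᵥ x := by
    simp [add_mulVec, smul_mulVec, hx]
  rw [← hc, mulVec_add, ← hx', mulVec_mulVec x, nonsing_inv_mul _
    ((isUnit_iff_isUnit_det _).1 (posDef_smul_add_gram hP hK hlam).isUnit), one_mulVec]

/-- Pythagoras on the feasible set `ker P`, around a point satisfying the optimality condition. -/
theorem sum_sq_residual_eq {P : Matrix m m ℝ} (hP : P.PosSemidef) {B : Matrix k m ℝ}
    {x w z : m → ℝ} {y : k → ℝ} (hx : P *ᵥ x = 0)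
    (hc : (Bᵀ * B) *ᵥ x + P *ᵥ w = Bᵀ *ᵥ y) (hz : P *ᵥ z = 0) :
    ∑ i, (y i - (B *ᵥ z) i) ^ 2 =
      ∑ i, (y i - (B *ᵥ x) i) ^ 2 + (B *ᵥ (z - x)) ⬝ᵥ (B *ᵥ (z - x)) := by
  have hsum (v : m → ℝ) : ∑ i, (y i - (B *ᵥ v) i) ^ 2 = (y - B *ᵥ v) ⬝ᵥ (y - B *ᵥ v) := by
    simp [dotProduct, sq]
  have horth : (B *ᵥ (z - x)) ⬝ᵥ (y - B *ᵥ x) = 0 := by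
    have h1 : Bᵀ *ᵥ (y - B *ᵥ x) = P *ᵥ w := by
      rw [mulVec_sub, ← hc, mulVec_mulVec, add_sub_cancel_left]
    rw [← vecMul_transpose, ← dotProduct_mulVec, h1, dotProduct_mulVec_comm hP, mulVec_sub, hz, hx]
    simp
  have hsplit : y - B *ᵥ z = (y - B *ᵥ x) - B *ᵥ (z - x) := by
    rw [mulVec_sub]
    abel
  rw [hsum, hsum, hsplit, sub_dotProduct, dotProduct_sub _ _ (B *ᵥ (z - x)),
    dotProduct_sub _ _ (B *ᵥ (z - x)),
    dotProduct_comm (y - B *ᵥ x) (B *ᵥ (z - x)), horth]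
  ring

end PenalizedLeastSquares

theorem PiMat_mulVec_apply (n : ℕ) (x : Fin (n + 3) → ℝ) (i : Fin (n + 1)) :
    (PiMat n *ᵥ x) i = x i.castSucc.succ := by
  have h (j : Fin (n + 3)) : (j : ℕ) = (i : ℕ) + 1 ↔ j = i.castSucc.succ := by
    simp [Fin.ext_iff]
  simp [PiMat, mulVec, dotProduct, h]

/-- An invertible corner submatrix forces `ker P ∩ ker Π` to be trivial. -/
theorem eq_zero_of_mulVec_of_PiMat_mulVec {n : ℕ} {P : Matrix (Fin (n + 3)) (Fin (n + 3)) ℝ}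
    (hQ : IsUnit !![P 0 0, P 0 (Fin.last (n + 2));
                    P (Fin.last (n + 2)) 0, P (Fin.last (n + 2)) (Fin.last (n + 2))])
    {x : Fin (n + 3) → ℝ} (hPx : P *ᵥ x = 0) (hx : PiMat n *ᵥ x = 0) : x = 0 := by
  have hmid (i : Fin (n + 1)) : x i.castSucc.succ = 0 := by
    rw [← PiMat_mulVec_apply n x, hx, Pi.zero_apply]
  have hrow (r : Fin (n + 3)) : P r 0 * x 0 + P r (Fin.last (n + 2)) * x (Fin.last (n + 2)) = 0 := by
    have h := congrFun hPx r
    rw [mulVec, dotProduct, Fin.sum_univ_succ, Fin.sum_univ_castSucc] at h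
    simpa [hmid] using h
  have hcorner : ![x 0, x (Fin.last (n + 2))] = 0 := by
    refine mulVec_injective_of_isUnit hQ ?_
    rw [mulVec_zero]
    ext r
    fin_cases r
    · simpa [mulVec, dotProduct] using hrow 0
    · simpa [mulVec, dotProduct] using hrow (Fin.last (n + 2))
  ext j
  refine Fin.cases ?_ (fun j => Fin.lastCases ?_ (fun i => ?_) j) j
  · simpa using congrFun hcorner 0
  · simpa using congrFun hcorner 1
  · exact hmid i

/-- Let P be (n+3)×(n+3) symmetric positive semidefinite with invertible 2×2
corner submatrix, y ∈ ℝ^{n+1}.  Then minimizing ‖y − Πx‖² over {x : Px = 0} has a unique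
minimizer x^∞, and (λP + ΠᵀΠ)⁻¹Πᵀy → x^∞ as λ → +∞. -/
theorem stmt19 (n : ℕ) (hn : 1 ≤ n)
    (P : Matrix (Fin (n + 3)) (Fin (n + 3)) ℝ) (hP : P.PosSemidef)
    (hQ : IsUnit !![P 0 0, P 0 (Fin.last (n + 2));
                    P (Fin.last (n + 2)) 0, P (Fin.last (n + 2)) (Fin.last (n + 2))])
    (y : Fin (n + 1) → ℝ) :
    ∃ xinf : Fin (n + 3) → ℝ,
      (P *ᵥ xinf = 0 ∧
        ∀ z : Fin (n + 3) → ℝ, P *ᵥ z = 0 →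
          ∑ i, (y i - (PiMat n *ᵥ xinf) i) ^ 2 ≤ ∑ i, (y i - (PiMat n *ᵥ z) i) ^ 2) ∧
      (∀ x' : Fin (n + 3) → ℝ,
        (P *ᵥ x' = 0 ∧
          ∀ z : Fin (n + 3) → ℝ, P *ᵥ z = 0 →
            ∑ i, (y i - (PiMat n *ᵥ x') i) ^ 2 ≤ ∑ i, (y i - (PiMat n *ᵥ z) i) ^ 2) →
        x' = xinf) ∧
      Tendsto (fun lam : ℝ => (lam • P + (PiMat n)ᵀ * PiMat n)⁻¹ *ᵥ ((PiMat n)ᵀ *ᵥ y))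
        atTop (𝓝 xinf) := by
  have hK : ∀ x, P *ᵥ x = 0 → PiMat n *ᵥ x = 0 → x = 0 :=
    fun x => eq_zero_of_mulVec_of_PiMat_mulVec hQ
  obtain ⟨x, w, hx, hc⟩ :=
    PenalizedLeastSquares.exists_gram_mulVec_add hP hK ((PiMat n)ᵀ *ᵥ y)
  refine ⟨x, ⟨hx, fun z hz => ?_⟩, fun x' ⟨hx', hmin⟩ => ?_,
    PenalizedLeastSquares.tendsto_inv_mulVec hP hK hx hc⟩
  · rw [PenalizedLeastSquares.sum_sq_residual_eq hP hx hc hz]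
    exact le_add_of_nonneg_right (Finset.sum_nonneg fun i _ => mul_self_nonneg _)
  · have h := hmin x hx
    rw [PenalizedLeastSquares.sum_sq_residual_eq hP hx hc hx'] at h
    have h0 : 0 ≤ (PiMat n *ᵥ (x' - x)) ⬝ᵥ (PiMat n *ᵥ (x' - x)) :=
      Finset.sum_nonneg fun i _ => mul_self_nonneg _
    refine sub_eq_zero.1 (hK _ (by rw [mulVec_sub, hx', hx, sub_zero]) ?_)
    exact dotProduct_self_eq_zero.1 (by linarith)
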